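/- Let G be a group and n ≥ 3. The map φ given by φ(σ_1, …, σ_{n-1}) = (σ_1, σ_1σ_2, …, σ_1σ_2⋯σ_{n-1}) is a bijection from the set A onto the set B, with inverse ψ given by ψ(α_1, …, α_{n-1}) = (α_1, α_1^{-1}α_2, α_2^{-1}α_3, …, α_{n-2}^{-1}α_{n-1}). -/

import Mathlib

/-- The ordered product `σ r * σ (r+1) * ⋯ * σ s` (empty if `s < r`). -/
def partialProd {G : Type*} [Group G] (σ : ℕ → G) (r s : ℕ) : G :=
  ((List.Ico r (s + 1)).map σ).prod

/-- The tuple `α` with the convention `α_0 := 1`. -/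
def withOne {G : Type*} [Group G] (α : ℕ → G) : ℕ → G :=
  fun k => if k = 0 then 1 else α k

/-- `φ(σ_1,…,σ_{n-1}) := (σ_1, σ_1σ_2, …, σ_1σ_2⋯σ_{n-1})`, i.e. the `j`-th
component is `α_j := σ_1 ⋯ σ_j`. -/
def phiOf {G : Type*} [Group G] (σ : ℕ → G) : ℕ → G :=
  fun j => partialProd σ 1 j

/-- `ψ(α_1,…,α_{n-1}) := (α_1, α_1⁻¹α_2, …, α_{n-2}⁻¹α_{n-1})`, i.e. the `i`-th
component is `σ_i := α_{i-1}⁻¹ α_i` with the convention `α_0 := 1`. -/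
def psiOf {G : Type*} [Group G] (α : ℕ → G) : ℕ → G :=
  fun i => (withOne α (i - 1))⁻¹ * withOne α i

/-- `A_J`, the subgroup generated by
`{τ_{r,s} = σ_r ⋯ σ_s : 1 ≤ r ≤ s ≤ n-1, r-1 ∈ J, s ∈ J}`. -/
def AJOf {G : Type*} [Group G] (σ : ℕ → G) (n : ℕ) (J : Set ℕ) : Subgroup G :=
  Subgroup.closure
    {g : G | ∃ r s : ℕ, 1 ≤ r ∧ r ≤ s ∧ s ≤ n - 1 ∧ r - 1 ∈ J ∧ s ∈ J ∧ g = partialProd σ r s}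

/-- `G_J⁺`, the subgroup generated by `{α_i⁻¹ α_j : i, j ∈ J}` (with `α_0 := 1`). -/
def GJplusOf {G : Type*} [Group G] (α : ℕ → G) (J : Set ℕ) : Subgroup G :=
  Subgroup.closure {g : G | ∃ i ∈ J, ∃ j ∈ J, g = (withOne α i)⁻¹ * withOne α j}

/-- The set `A` of tuples `(σ_1,…,σ_{n-1})` such that: (i) the `σ_i` generate `G`;
(ii) every `σ_i` has order different from 1 and 2; (iii) `(σ_i ⋯ σ_j)² = 1` for all
`1 ≤ i < j ≤ n-1`; (iv) `A_I ∩ A_J = A_{I∩J}` for all `I, J ⊆ {0,…,n-1}`. -/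
def setA (G : Type*) [Group G] (n : ℕ) : Set (ℕ → G) :=
  {σ | Subgroup.closure {g : G | ∃ i, 1 ≤ i ∧ i ≤ n - 1 ∧ g = σ i} = ⊤
    ∧ (∀ i, 1 ≤ i → i ≤ n - 1 → orderOf (σ i) ≠ 1 ∧ orderOf (σ i) ≠ 2)
    ∧ (∀ i j, 1 ≤ i → i < j → j ≤ n - 1 → (partialProd σ i j) ^ 2 = 1)
    ∧ (∀ I J : Set ℕ, I ⊆ Set.Iic (n - 1) → J ⊆ Set.Iic (n - 1) →
        AJOf σ n I ⊓ AJOf σ n J = AJOf σ n (I ∩ J))}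

/-- The set `B` of tuples `(α_1,…,α_{n-1})` such that: (i) the `α_i` generate `G`;
(ii) for all `0 ≤ i, j ≤ n-1` (with `α_0 := 1`), `α_i⁻¹ α_j` has order exactly 2
whenever `|i-j| ≥ 2` and does not have order 2 whenever `|i-j| = 1`;
(iii) `G_J⁺ ∩ G_K⁺ = G_{J∩K}⁺` for all `J, K ⊆ {0,…,n-1}` with `|J|, |K| ≥ 2`. -/
def setB (G : Type*) [Group G] (n : ℕ) : Set (ℕ → G) :=
  {α | Subgroup.closure {g : G | ∃ i, 1 ≤ i ∧ i ≤ n - 1 ∧ g = α i} = ⊤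
    ∧ (∀ i j, i ≤ n - 1 → j ≤ n - 1 →
        (2 ≤ |(i : ℤ) - (j : ℤ)| → orderOf ((withOne α i)⁻¹ * withOne α j) = 2)
          ∧ (|(i : ℤ) - (j : ℤ)| = 1 → orderOf ((withOne α i)⁻¹ * withOne α j) ≠ 2))
    ∧ (∀ J K : Set ℕ, J ⊆ Set.Iic (n - 1) → K ⊆ Set.Iic (n - 1) →
        2 ≤ J.ncard → 2 ≤ K.ncard →
        GJplusOf α J ⊓ GJplusOf α K = GJplusOf α (J ∩ K))}

theorem partialProd_of_lt {G : Type*} [Group G] (σ : ℕ → G) {r s : ℕ} (h : s < r) :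
    partialProd σ r s = 1 := by
  simp [partialProd, List.Ico.eq_nil_of_le (Nat.succ_le_of_lt h)]

theorem partialProd_succ {G : Type*} [Group G] (σ : ℕ → G) {r s : ℕ} (h : r ≤ s + 1) :
    partialProd σ r (s + 1) = partialProd σ r s * σ (s + 1) := by
  simp [partialProd, List.Ico.succ_top h]

theorem partialProd_self {G : Type*} [Group G] (σ : ℕ → G) (r : ℕ) :
    partialProd σ r r = σ r := by
  simp [partialProd]

theorem partialProd_mul {G : Type*} [Group G] (σ : ℕ → G) {r s t : ℕ} (h₁ : r ≤ s + 1)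
    (h₂ : s ≤ t) :
    partialProd σ r s * partialProd σ (s + 1) t = partialProd σ r t := by
  simp [partialProd, ← List.prod_append, ← List.map_append,
    List.Ico.append_consecutive h₁ (Nat.succ_le_succ h₂)]

/-- `σ` is the tuple of successive quotients of `α`: `σ_r ⋯ σ_s = α_{r-1}⁻¹ α_s`. -/
def IsQuotientTuple {G : Type*} [Group G] (σ α : ℕ → G) : Prop :=
  ∀ r s : ℕ, r ≤ s → partialProd σ (r + 1) s = (withOne α r)⁻¹ * withOne α s

@[simp]
theorem withOne_zero {G : Type*} [Group G] (α : ℕ → G) : withOne α 0 = 1 := by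
  simp [withOne]

theorem withOne_of_pos {G : Type*} [Group G] (α : ℕ → G) {k : ℕ} (hk : 1 ≤ k) :
    withOne α k = α k := by
  simp [withOne, Nat.one_le_iff_ne_zero.mp hk]

theorem withOne_phiOf {G : Type*} [Group G] (σ : ℕ → G) (k : ℕ) :
    withOne (phiOf σ) k = partialProd σ 1 k := by
  rcases Nat.eq_zero_or_pos k with rfl | hk
  · simp [partialProd_of_lt]
  · rw [withOne_of_pos _ hk, phiOf]

theorem isQuotientTuple_phiOf {G : Type*} [Group G] (σ : ℕ → G) :
    IsQuotientTuple σ (phiOf σ) := by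
  intro r s h
  rw [withOne_phiOf, withOne_phiOf, eq_inv_mul_iff_mul_eq]
  exact partialProd_mul σ (Nat.le_add_left 1 r) h

theorem isQuotientTuple_psiOf {G : Type*} [Group G] (α : ℕ → G) :
    IsQuotientTuple (psiOf α) α := by
  intro r s h
  induction s, h using Nat.le_induction with
  | base => simp [partialProd_of_lt]
  | succ s h ih =>
    rw [partialProd_succ _ (Nat.succ_le_succ h), ih]
    simp [psiOf, mul_assoc]

namespace IsQuotientTuple

variable {G : Type*} [Group G] {σ α : ℕ → G}

theorem apply_succ (h : IsQuotientTuple σ α) (r : ℕ) :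
    σ (r + 1) = (withOne α r)⁻¹ * withOne α (r + 1) := by
  rw [← partialProd_self σ (r + 1)]
  exact h r (r + 1) r.le_succ

theorem eq_partialProd (h : IsQuotientTuple σ α) {j : ℕ} (hj : 1 ≤ j) :
    α j = partialProd σ 1 j := by
  have := h 0 j j.zero_le
  simpa [withOne_of_pos α hj] using this.symm

theorem AJOf_eq (h : IsQuotientTuple σ α) {n : ℕ} {J : Set ℕ} (hJ : J ⊆ Set.Iic (n - 1)) :
    AJOf σ n J = GJplusOf α J := by
  have key : ∀ i ∈ J, ∀ j ∈ J, i ≤ j → (withOne α i)⁻¹ * withOne α j ∈ AJOf σ n J := by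
    intro i hi j hj hij
    rcases hij.eq_or_lt with rfl | hlt
    · simp
    · exact Subgroup.subset_closure
        ⟨i + 1, j, by omega, hlt, hJ hj, by simpa using hi, hj, (h i j hij).symm⟩
  apply le_antisymm
  · refine (Subgroup.closure_le _).mpr ?_
    rintro g ⟨r, s, h1, hrs, -, hr, hs, rfl⟩
    obtain ⟨r, rfl⟩ := Nat.exists_eq_add_of_le' h1
    exact Subgroup.subset_closure ⟨r, hr, s, hs, h r s (by omega)⟩
  · refine (Subgroup.closure_le _).mpr ?_
    rintro g ⟨i, hi, j, hj, rfl⟩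
    rcases le_total i j with hij | hij
    · exact key i hi j hj hij
    · simpa using inv_mem (key j hj i hi hij)

theorem closure_eq (h : IsQuotientTuple σ α) (m : ℕ) :
    Subgroup.closure {g : G | ∃ i, 1 ≤ i ∧ i ≤ m ∧ g = σ i} =
      Subgroup.closure {g : G | ∃ i, 1 ≤ i ∧ i ≤ m ∧ g = α i} := by
  apply le_antisymm
  · refine (Subgroup.closure_le _).mpr ?_
    rintro g ⟨i, h1, hi, rfl⟩
    have key : ∀ k ≤ m, withOne α k ∈
        Subgroup.closure {g : G | ∃ i, 1 ≤ i ∧ i ≤ m ∧ g = α i} := by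
      intro k hk
      rcases Nat.eq_zero_or_pos k with rfl | hpos
      · simp
      · rw [withOne_of_pos α hpos]
        exact Subgroup.subset_closure ⟨k, hpos, hk, rfl⟩
    obtain ⟨r, rfl⟩ := Nat.exists_eq_add_of_le' h1
    rw [h.apply_succ]
    exact mul_mem (inv_mem (key r (by omega))) (key _ hi)
  · refine (Subgroup.closure_le _).mpr ?_
    rintro g ⟨j, h1, hj, rfl⟩
    rw [h.eq_partialProd h1]
    refine list_prod_mem fun x hx => ?_
    obtain ⟨i, hi, rfl⟩ := List.mem_map.mp hx
    rw [List.Ico.mem] at hi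
    exact Subgroup.subset_closure ⟨i, hi.1, by omega, rfl⟩

end IsQuotientTuple

theorem GJplusOf_of_subsingleton {G : Type*} [Group G] (α : ℕ → G) {J : Set ℕ}
    (hJ : J.Subsingleton) : GJplusOf α J = ⊥ := by
  refine (Subgroup.closure_eq_bot_iff).mpr ?_
  rintro g ⟨i, hi, j, hj, rfl⟩
  simp [hJ hi hj]

theorem GJplusOf_pair_le {G : Type*} [Group G] (α : ℕ → G) {i j k : ℕ}
    (h : withOne α i = withOne α j) : GJplusOf α {i, k} ≤ GJplusOf α {j, k} := by
  refine (Subgroup.closure_le _).mpr ?_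
  have key : ∀ a ∈ ({i, k} : Set ℕ), ∃ b ∈ ({j, k} : Set ℕ), withOne α a = withOne α b := by
    rintro a (rfl | rfl)
    · exact ⟨j, by simp, h⟩
    · exact ⟨a, by simp, rfl⟩
  rintro g ⟨a, ha, b, hb, rfl⟩
  obtain ⟨a', ha', h₁⟩ := key a ha
  obtain ⟨b', hb', h₂⟩ := key b hb
  exact Subgroup.subset_closure ⟨a', ha', b', hb', by rw [h₁, h₂]⟩

/-- If two entries coincide, then the intersection property for pairs forces every other entry
to agree with them. -/
theorem withOne_eq_of_inf_eq {G : Type*} [Group G] (α : ℕ → G) {i j k : ℕ} (hij : i ≠ j)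
    (hI : GJplusOf α {i, k} ⊓ GJplusOf α {j, k} = GJplusOf α ({i, k} ∩ {j, k}))
    (h : withOne α i = withOne α j) : withOne α i = withOne α k := by
  have hsub : (({i, k} : Set ℕ) ∩ {j, k}).Subsingleton := by
    rintro x ⟨hx₁, hx₂⟩ y ⟨hy₁, hy₂⟩
    simp only [Set.mem_insert_iff, Set.mem_singleton_iff] at hx₁ hx₂ hy₁ hy₂
    omega
  rw [inf_eq_left.mpr (GJplusOf_pair_le α h), GJplusOf_of_subsingleton α hsub] at hI
  have hmem : (withOne α i)⁻¹ * withOne α k ∈ GJplusOf α {i, k} :=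
    Subgroup.subset_closure ⟨i, by simp, k, by simp, rfl⟩
  rw [hI, Subgroup.mem_bot, inv_mul_eq_one] at hmem
  exact hmem

theorem orderOf_inv_mul_comm {G : Type*} [Group G] (a b : G) :
    orderOf (a⁻¹ * b) = orderOf (b⁻¹ * a) := by
  rw [← orderOf_inv]
  simp

theorem phiOf_mem_setB {G : Type*} [Group G] {n : ℕ} {σ : ℕ → G} (hσ : σ ∈ setA G n) :
    phiOf σ ∈ setB G n := by
  obtain ⟨hgen, hord, hsq, hinf⟩ := hσ
  have hq := isQuotientTuple_phiOf σ
  have hinf' : ∀ J K : Set ℕ, J ⊆ Set.Iic (n - 1) → K ⊆ Set.Iic (n - 1) →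
      GJplusOf (phiOf σ) J ⊓ GJplusOf (phiOf σ) K = GJplusOf (phiOf σ) (J ∩ K) := by
    intro J K hJ hK
    rw [← hq.AJOf_eq hJ, ← hq.AJOf_eq hK, ← hq.AJOf_eq (Set.inter_subset_left.trans hJ)]
    exact hinf J K hJ hK
  have hfar : ∀ i j, i + 2 ≤ j → j ≤ n - 1 →
      orderOf ((withOne (phiOf σ) i)⁻¹ * withOne (phiOf σ) j) = 2 := by
    intro i j hij hj
    refine orderOf_eq_prime ?_ ?_
    · rw [← hq i j (by omega)]
      exact hsq (i + 1) j (by omega) (by omega) hj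
    · intro h
      have hik := withOne_eq_of_inf_eq (phiOf σ) (k := i + 1) (by omega)
        (hinf' {i, i + 1} {j, i + 1} (by simp [Set.insert_subset_iff]; omega)
          (by simp [Set.insert_subset_iff]; omega)) (inv_mul_eq_one.mp h)
      apply (hord (i + 1) (by omega) (by omega)).1
      rw [hq.apply_succ, hik]
      simp
  have hnear : ∀ i, i + 1 ≤ n - 1 →
      orderOf ((withOne (phiOf σ) i)⁻¹ * withOne (phiOf σ) (i + 1)) ≠ 2 := by
    intro i hi
    rw [← hq.apply_succ]
    exact (hord (i + 1) (by omega) hi).2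
  refine ⟨(hq.closure_eq (n - 1)).symm.trans hgen, fun i j hi hj => ⟨fun h => ?_, fun h => ?_⟩,
    fun J K hJ hK _ _ => hinf' J K hJ hK⟩
  · rw [le_abs] at h
    rcases le_total i j with hij | hij
    · exact hfar i j (by omega) hj
    · rw [orderOf_inv_mul_comm]
      exact hfar j i (by omega) hi
  · rw [abs_eq zero_le_one] at h
    rcases le_total i j with hij | hij
    · obtain rfl : j = i + 1 := by omega
      exact hnear i hj
    · obtain rfl : i = j + 1 := by omega
      rw [orderOf_inv_mul_comm]
      exact hnear j hi

theorem psiOf_mem_setA {G : Type*} [Group G] {n : ℕ} (hn : 3 ≤ n) {α : ℕ → G}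
    (hα : α ∈ setB G n) : psiOf α ∈ setA G n := by
  obtain ⟨hgen, hord, hinf⟩ := hα
  have hq := isQuotientTuple_psiOf α
  have hinf' : ∀ J K : Set ℕ, J ⊆ Set.Iic (n - 1) → K ⊆ Set.Iic (n - 1) →
      GJplusOf α J ⊓ GJplusOf α K = GJplusOf α (J ∩ K) := by
    have hss : ∀ J : Set ℕ, J ⊆ Set.Iic (n - 1) → ¬ 2 ≤ J.ncard → J.Subsingleton := by
      intro J hJ h
      have : Finite J := (Set.finite_Iic (n - 1)).subset hJ
      exact Set.ncard_le_one_iff_subsingleton.mp (by omega)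
    intro J K hJ hK
    by_cases h₁ : 2 ≤ J.ncard
    · by_cases h₂ : 2 ≤ K.ncard
      · exact hinf J K hJ hK h₁ h₂
      · have hK' := hss K hK h₂
        rw [GJplusOf_of_subsingleton α hK',
          GJplusOf_of_subsingleton α (hK'.anti Set.inter_subset_right), inf_bot_eq]
    · have hJ' := hss J hJ h₁
      rw [GJplusOf_of_subsingleton α hJ',
        GJplusOf_of_subsingleton α (hJ'.anti Set.inter_subset_left), bot_inf_eq]
  have hfar : ∀ i j, i + 2 ≤ j → j ≤ n - 1 → orderOf ((withOne α i)⁻¹ * withOne α j) = 2 :=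
    fun i j hij hj => (hord i j (by omega) hj).1 (le_abs.mpr (by omega))
  have hne : ∀ i j, i + 2 ≤ j → j ≤ n - 1 → withOne α i ≠ withOne α j := by
    intro i j hij hj h
    have := hfar i j hij hj
    simp [h] at this
  refine ⟨(hq.closure_eq (n - 1)).trans hgen, fun i h1 hi => ?_, fun i j h1 hij hj => ?_,
    fun I J hI hJ => ?_⟩
  · obtain ⟨r, rfl⟩ := Nat.exists_eq_add_of_le' h1
    rw [hq.apply_succ]
    refine ⟨fun h => ?_, (hord r (r + 1) (by omega) hi).2 (by simp)⟩
    rw [orderOf_eq_one_iff, inv_mul_eq_one] at h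
    have hk : ∀ k ≤ n - 1, withOne α r = withOne α k := fun k hk =>
      withOne_eq_of_inf_eq α (by omega)
        (hinf' {r, k} {r + 1, k} (by simp [Set.insert_subset_iff]; omega)
          (by simp [Set.insert_subset_iff]; omega)) h
    exact hne 0 2 (by omega) (by omega) ((hk 0 (by omega)).symm.trans (hk 2 (by omega)))
  · obtain ⟨r, rfl⟩ := Nat.exists_eq_add_of_le' h1
    rw [hq r j (by omega), ← hfar r j (by omega) hj]
    exact pow_orderOf_eq_one _
  · rw [hq.AJOf_eq hI, hq.AJOf_eq hJ, hq.AJOf_eq (Set.inter_subset_left.trans hI)]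
    exact hinf' I J hI hJ

/-- `φ : A → B` is a bijection with inverse `ψ`: `φ` maps `A` into `B`, `ψ` maps `B`
into `A`, and the two maps are mutually inverse on tuples of `n-1` elements
(components indexed `1 ≤ i ≤ n-1`). -/
theorem phi_bijection_setA_setB {G : Type*} [Group G] (n : ℕ) (hn : 3 ≤ n) :
    (∀ σ ∈ setA G n, phiOf σ ∈ setB G n)
      ∧ (∀ α ∈ setB G n, psiOf α ∈ setA G n)
      ∧ (∀ σ ∈ setA G n, ∀ i, 1 ≤ i → i ≤ n - 1 → psiOf (phiOf σ) i = σ i)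
      ∧ (∀ α ∈ setB G n, ∀ j, 1 ≤ j → j ≤ n - 1 → phiOf (psiOf α) j = α j) := by
  refine ⟨fun σ hσ => phiOf_mem_setB hσ, fun α hα => psiOf_mem_setA hn hα,
    fun σ _ i h1 _ => ?_, fun α _ j h1 _ => ?_⟩
  · obtain ⟨r, rfl⟩ := Nat.exists_eq_add_of_le' h1
    exact ((isQuotientTuple_phiOf σ).apply_succ r).symm
  · exact ((isQuotientTuple_psiOf α).eq_partialProd h1).symm
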